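/- arXiv:2207.08800 — 6 statements merged into one kernel-verified Lean document; each statement's English description precedes it below -/
import Mathlib

section
/- Let d ≥ 1 be an integer, let q ∈ [2, ∞) be a real number, and set t = 2q/(q+2) (equivalently, 1/t = 1/q + 1/2, so t ∈ [1,2)). Let a, b ∈ ℝ^d have nonnegative entries with ‖a‖₂ ≤ 1 and ‖b‖₂ ≤ 1, and define p, p̃ ∈ ℝ^d by p_j = a_j² and p̃_j = b_j². Then ‖p − p̃‖_t ≤ 2·‖a − b‖_q. -/
open Finset

/-- Let `d ≥ 1`, `q ∈ [2,∞)`, `t = 2q/(q+2)`. If `a, b ∈ ℝ^d` are entrywise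
nonnegative with `‖a‖₂ ≤ 1`, `‖b‖₂ ≤ 1`, and `p_j = a_j²`, `p̃_j = b_j²`, then
`‖p − p̃‖_t ≤ 2·‖a − b‖_q`. -/
theorem stmt_1 (d : ℕ) (hd : 1 ≤ d) (q t : ℝ) (hq : 2 ≤ q) (ht : t = 2 * q / (q + 2))
    (a b : Fin d → ℝ) (ha : ∀ j, 0 ≤ a j) (hb : ∀ j, 0 ≤ b j)
    (ha2 : (∑ j, |a j| ^ (2 : ℝ)) ^ ((2 : ℝ)⁻¹) ≤ 1)
    (hb2 : (∑ j, |b j| ^ (2 : ℝ)) ^ ((2 : ℝ)⁻¹) ≤ 1) :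
    (∑ j, |a j ^ 2 - b j ^ 2| ^ t) ^ (1 / t) ≤
      2 * (∑ j, |a j - b j| ^ q) ^ (1 / q) := by
  have htri : Real.HolderTriple q 2 t := by
    refine ⟨?_, by positivity, by norm_num⟩
    rw [ht]
    field_simp
    ring
  have hplus : (∑ j, |a j + b j| ^ (2 : ℝ)) ^ (1 / (2 : ℝ)) ≤ 2 := by
    have h := Real.Lp_add_le univ a b (p := 2) one_le_two
    rw [← one_div] at ha2 hb2
    linarith
  have hfactor : ∀ j, |a j ^ 2 - b j ^ 2| = |(a j - b j) * (a j + b j)| := fun j => by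
    ring_nf
  simp only [hfactor]
  calc (∑ j, |(a j - b j) * (a j + b j)| ^ t) ^ (1 / t)
      ≤ (∑ j, |a j - b j| ^ q) ^ (1 / q) * (∑ j, |a j + b j| ^ (2 : ℝ)) ^ (1 / (2 : ℝ)) := by
        simpa [abs_mul] using NNReal.coe_le_coe.2 <|
          NNReal.Lr_le_Lp_mul_Lq univ (fun j => ‖a j - b j‖₊) (fun j => ‖a j + b j‖₊) htri
    _ ≤ (∑ j, |a j - b j| ^ q) ^ (1 / q) * 2 := by gcongr
    _ = 2 * (∑ j, |a j - b j| ^ q) ^ (1 / q) := mul_comm _ _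
end

section
/- For every integer k ≥ 1, every real p ∈ [0,1] and every real ε > 0, the binomial tail satisfies Σ_{i ∈ {0,…,k}, |i/k − p| > ε} C(k,i)·p^i·(1−p)^{k−i} ≤ 2·exp(−ε²·k/(2(p+ε))), where C(k,i) is the binomial coefficient. -/
open Finset

/-- Exponential Markov inequality for sums of binomial weights. -/
lemma sum_binomial_le_exp {k : ℕ} {p : ℝ} (hp0 : 0 ≤ p) (hp1 : p ≤ 1) (t c : ℝ)
    {S : Finset ℕ} (hS : S ⊆ range (k + 1)) (hc : ∀ i ∈ S, c ≤ t * i) :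
    ∑ i ∈ S, (k.choose i : ℝ) * p ^ i * (1 - p) ^ (k - i) ≤
      Real.exp (k * (p * (Real.exp t - 1)) - c) := by
  have hq : 0 ≤ 1 - p := by linarith
  calc ∑ i ∈ S, (k.choose i : ℝ) * p ^ i * (1 - p) ^ (k - i)
      ≤ ∑ i ∈ S, (k.choose i : ℝ) * p ^ i * (1 - p) ^ (k - i) * Real.exp (t * i - c) := by
        refine sum_le_sum fun i hi => le_mul_of_one_le_right (by positivity) ?_
        exact Real.one_le_exp (sub_nonneg.2 (hc i hi))
    _ ≤ ∑ i ∈ range (k + 1),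
          (k.choose i : ℝ) * p ^ i * (1 - p) ^ (k - i) * Real.exp (t * i - c) :=
        sum_le_sum_of_subset_of_nonneg hS fun i _ _ => by positivity
    _ = (p * Real.exp t + (1 - p)) ^ k * Real.exp (-c) := by
        rw [add_pow, sum_mul]
        refine sum_congr rfl fun i _ => ?_
        rw [mul_pow, ← Real.exp_nat_mul, sub_eq_add_neg (t * i), Real.exp_add, mul_comm t]
        ring
    _ ≤ Real.exp (p * (Real.exp t - 1)) ^ k * Real.exp (-c) := by
        gcongr
        linarith [Real.add_one_le_exp (p * (Real.exp t - 1))]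
    _ = Real.exp (k * (p * (Real.exp t - 1)) - c) := by
        rw [← Real.exp_nat_mul, ← Real.exp_add, ← sub_eq_add_neg]

lemma exp_neg_le_quadratic {s : ℝ} (hs : 0 ≤ s) : Real.exp (-s) ≤ 1 - s + s ^ 2 / 2 := by
  have h := Real.quadratic_le_exp_of_nonneg hs
  rw [Real.exp_neg, inv_le_iff_one_le_mul₀ (Real.exp_pos s)]
  nlinarith [sq_nonneg (s ^ 2), sq_nonneg (s - 1)]

lemma add_sq_div_two_le_neg_log_one_sub {x : ℝ} (h0 : 0 ≤ x) (h1 : x < 1) :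
    x + x ^ 2 / 2 ≤ -Real.log (1 - x) := by
  have h := sum_le_hasSum (range 2) (fun i _ => by positivity)
    (Real.hasSum_pow_div_log_of_abs_lt_one (abs_lt.2 ⟨by linarith, h1⟩))
  norm_num [sum_range_succ] at h
  linarith

/-- A good exponential tilt for the upper tail. -/
lemma exists_upper_tilt {p ε : ℝ} (hp0 : 0 ≤ p) (hε : 0 < ε) :
    ∃ t : ℝ, 0 ≤ t ∧ p * (Real.exp t - 1) - t * (p + ε) ≤ -ε ^ 2 / (2 * (p + ε)) := by
  obtain rfl | hp := hp0.eq_or_lt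
  · refine ⟨1 / 2, by norm_num, le_of_eq ?_⟩
    field_simp
    ring
  · have hq : 0 < p + ε := by linarith
    have hx : 1 - ε / (p + ε) = p / (p + ε) := by field_simp; ring
    have h := add_sq_div_two_le_neg_log_one_sub (x := ε / (p + ε)) (by positivity)
      ((div_lt_one hq).2 (by linarith))
    rw [hx] at h
    refine ⟨-Real.log (p / (p + ε)), le_trans (by positivity) h, ?_⟩
    rw [Real.exp_neg, Real.exp_log (by positivity)]
    have h2 := mul_le_mul_of_nonneg_right h hq.le
    have h3 : (ε / (p + ε) + (ε / (p + ε)) ^ 2 / 2) * (p + ε) = ε - -ε ^ 2 / (2 * (p + ε)) := by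
      field_simp
      ring
    have h4 : p * ((p / (p + ε))⁻¹ - 1) = ε := by field_simp; ring
    linarith

/-- A good exponential tilt for the lower tail. -/
lemma exists_lower_tilt {p ε : ℝ} (hp0 : 0 ≤ p) (hε : 0 < ε) :
    ∃ s : ℝ, 0 ≤ s ∧ p * (Real.exp (-s) - 1) + s * (p - ε) ≤ -ε ^ 2 / (2 * (p + ε)) := by
  have hq : 0 < p + ε := by linarith
  have hs : 0 ≤ ε / (p + ε) := by positivity
  refine ⟨ε / (p + ε), hs, ?_⟩
  have h := mul_le_mul_of_nonneg_left (exp_neg_le_quadratic hs) hp0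
  have h2 : (p + ε) * (ε / (p + ε)) ^ 2 / 2 - ε / (p + ε) * ε = -ε ^ 2 / (2 * (p + ε)) := by
    field_simp
    ring
  nlinarith [mul_nonneg hε.le (sq_nonneg (ε / (p + ε)))]

/-- Chernoff-type binomial tail bound: for every integer `k ≥ 1`, real `p ∈ [0,1]`
and real `ε > 0`,
`Σ_{i ∈ {0,…,k}, |i/k − p| > ε} C(k,i)·p^i·(1−p)^{k−i} ≤ 2·exp(−ε²·k/(2(p+ε)))`. -/
theorem stmt_5 (k : ℕ) (hk : 1 ≤ k) (p ε : ℝ) (hp0 : 0 ≤ p) (hp1 : p ≤ 1) (hε : 0 < ε) :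
    ∑ i ∈ (Finset.range (k + 1)).filter (fun i : ℕ => ε < |(i : ℝ) / k - p|),
        (k.choose i : ℝ) * p ^ i * (1 - p) ^ (k - i) ≤
      2 * Real.exp (-(ε ^ 2 * k) / (2 * (p + ε))) := by
  have hk0 : (0 : ℝ) < k := by exact_mod_cast hk
  have hq : 0 ≤ 1 - p := by linarith
  have hexp : -(ε ^ 2 * k) / (2 * (p + ε)) = k * (-ε ^ 2 / (2 * (p + ε))) := by ring
  obtain ⟨t, ht, hupper⟩ := exists_upper_tilt hp0 hε
  obtain ⟨s, hs, hlower⟩ := exists_lower_tilt hp0 hε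
  have hU := sum_binomial_le_exp hp0 hp1 t (t * (k * (p + ε)))
    (filter_subset (fun i : ℕ => ε < (i : ℝ) / k - p) (range (k + 1))) fun i hi => by
      have h := (mem_filter.1 hi).2
      rw [lt_sub_iff_add_lt, lt_div_iff₀ hk0] at h
      exact mul_le_mul_of_nonneg_left (by linarith) ht
  have hL := sum_binomial_le_exp hp0 hp1 (-s) (-s * (k * (p - ε)))
    (filter_subset (fun i : ℕ => ε < -((i : ℝ) / k - p)) (range (k + 1))) fun i hi => by
      have h : (i : ℝ) / k < p - ε := by linarith [(mem_filter.1 hi).2]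
      rw [div_lt_iff₀ hk0] at h
      exact mul_le_mul_of_nonpos_left (by linarith) (by linarith)
  have hU' := hU.trans (Real.exp_le_exp.2 (show _ ≤ -(ε ^ 2 * k) / (2 * (p + ε)) by
    rw [hexp]; linarith [mul_le_mul_of_nonneg_left hupper hk0.le]))
  have hL' := hL.trans (Real.exp_le_exp.2 (show _ ≤ -(ε ^ 2 * k) / (2 * (p + ε)) by
    rw [hexp]; linarith [mul_le_mul_of_nonneg_left hlower hk0.le]))
  simp only [lt_abs, filter_or]
  have hsum := sum_union_inter (s₁ := (range (k + 1)).filter (fun i : ℕ => ε < (i : ℝ) / k - p))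
    (s₂ := (range (k + 1)).filter (fun i : ℕ => ε < -((i : ℝ) / k - p)))
    (f := fun i : ℕ => (k.choose i : ℝ) * p ^ i * (1 - p) ^ (k - i))
  have hinter : 0 ≤ ∑ i ∈ (range (k + 1)).filter (fun i : ℕ => ε < (i : ℝ) / k - p) ∩
      (range (k + 1)).filter (fun i : ℕ => ε < -((i : ℝ) / k - p)),
      (k.choose i : ℝ) * p ^ i * (1 - p) ^ (k - i) :=
    sum_nonneg fun i _ => by positivity
  linarith
end

section
/- For every integer M ≥ 1, the integral ∫_{−π}^{π} cos(x)·sin(Mx/2)²/sin(x/2)² dx equals 2π(M−1). -/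
open Real

theorem integral_cos_nat_mul (k : ℕ) :
    ∫ x in (-π)..π, cos (k * x) = if k = 0 then 2 * π else 0 := by
  split_ifs with h
  · simp [h]
    ring
  · have hk : (k : ℝ) ≠ 0 := Nat.cast_ne_zero.mpr h
    rw [intervalIntegral.integral_comp_mul_left (fun x => cos x) hk]
    simp [Real.sin_nat_mul_pi]

/-- Closed form of the Dirichlet kernel. -/
theorem sin_mul_dirichlet_sum (m : ℕ) (x : ℝ) :
    sin (x / 2) * (1 + ∑ k ∈ Finset.range m, 2 * cos ((k + 1) * x)) =
      sin ((2 * m + 1) * (x / 2)) := by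
  induction m with
  | zero => simp
  | succ m ih =>
    rw [Finset.sum_range_succ, ← add_assoc, mul_add, ih]
    have h1 : (2 * (m : ℝ) + 1) * (x / 2) = (m + 1) * x - x / 2 := by ring
    have h2 : (2 * ((m + 1 : ℕ) : ℝ) + 1) * (x / 2) = (m + 1) * x + x / 2 := by
      push_cast; ring
    rw [h1, h2, sin_sub, sin_add]
    ring

/-- Closed form of the Fejér kernel. -/
theorem sin_sq_mul_fejer_sum (M : ℕ) (x : ℝ) :
    sin (x / 2) ^ 2 *
        ∑ m ∈ Finset.range M, (1 + ∑ k ∈ Finset.range m, 2 * cos ((k + 1) * x)) =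
      sin (M * x / 2) ^ 2 := by
  induction M with
  | zero => simp
  | succ M ih =>
    rw [Finset.sum_range_succ, mul_add, ih, sq (sin (x / 2)), mul_assoc, sin_mul_dirichlet_sum]
    have h1 : (2 * (M : ℝ) + 1) * (x / 2) = M * x / 2 + (M * x / 2 + x / 2) := by ring
    have h2 : ((M + 1 : ℕ) : ℝ) * x / 2 = M * x / 2 + x / 2 := by push_cast; ring
    rw [h1, h2, sin_add (M * x / 2) (M * x / 2 + x / 2), sin_add, cos_add]
    linear_combination -sin (M * x / 2) ^ 2 * sin_sq_add_cos_sq (x / 2)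

theorem integral_cos_mul_dirichlet_sum (m : ℕ) :
    ∫ x in (-π)..π, cos x * (1 + ∑ k ∈ Finset.range m, 2 * cos ((k + 1) * x)) =
      if m = 0 then 0 else 2 * π := by
  have h (x : ℝ) : cos x * (1 + ∑ k ∈ Finset.range m, 2 * cos ((k + 1) * x)) =
      cos x + ∑ k ∈ Finset.range m, (cos ((k + 2 : ℕ) * x) + cos (k * x)) := by
    rw [mul_add, mul_one, Finset.mul_sum]
    congr 1
    refine Finset.sum_congr rfl fun k _ => ?_
    have h1 : ((k + 2 : ℕ) : ℝ) * x = (k + 1) * x + x := by push_cast; ring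
    have h2 : (k : ℝ) * x = (k + 1) * x - x := by ring
    rw [h1, h2, cos_add, cos_sub]
    ring
  simp_rw [h]
  rw [intervalIntegral.integral_add (Continuous.intervalIntegrable (by fun_prop) _ _)
      (Continuous.intervalIntegrable (by fun_prop) _ _),
    intervalIntegral.integral_finsetSum
      fun k _ => Continuous.intervalIntegrable (by fun_prop) _ _]
  have h3 (k : ℕ) : ∫ x in (-π)..π, (cos ((k + 2 : ℕ) * x) + cos (k * x)) =
      if k = 0 then 2 * π else 0 := by
    rw [intervalIntegral.integral_add (Continuous.intervalIntegrable (by fun_prop) _ _)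
      (Continuous.intervalIntegrable (by fun_prop) _ _),
      integral_cos_nat_mul, integral_cos_nat_mul]
    simp
  simp_rw [h3]
  rcases m with _ | m <;> simp

/-- For every integer `M ≥ 1`,
`∫_{−π}^{π} cos(x)·sin(Mx/2)²/sin(x/2)² dx = 2π(M−1)`. -/
theorem stmt_6 (M : ℕ) (hM : 1 ≤ M) :
    ∫ x in (-π)..π, Real.cos x * Real.sin (M * x / 2) ^ 2 / Real.sin (x / 2) ^ 2 =
      2 * π * ((M : ℝ) - 1) := by
  have hae : ∫ x in (-π)..π, cos x * sin (M * x / 2) ^ 2 / sin (x / 2) ^ 2 =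
      ∫ x in (-π)..π, ∑ m ∈ Finset.range M,
        cos x * (1 + ∑ k ∈ Finset.range m, 2 * cos ((k + 1) * x)) := by
    refine intervalIntegral.integral_congr_ae ?_
    filter_upwards [MeasureTheory.Measure.ae_ne MeasureTheory.volume (0 : ℝ)] with x hx hmem
    rw [Set.uIoc_of_le (by linarith [pi_pos])] at hmem
    have hs : sin (x / 2) ≠ 0 := by
      rw [Ne, sin_eq_zero_iff_of_lt_of_lt (by linarith [hmem.1, pi_pos])
        (by linarith [hmem.2, pi_pos])]
      exact div_ne_zero hx two_ne_zero
    rw [← Finset.mul_sum, ← sin_sq_mul_fejer_sum]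
    field_simp
  rw [hae, intervalIntegral.integral_finsetSum
    fun m _ => Continuous.intervalIntegrable (by fun_prop) _ _]
  simp_rw [integral_cos_mul_dirichlet_sum]
  obtain ⟨n, rfl⟩ := Nat.exists_eq_add_of_le' hM
  rw [Finset.sum_range_succ']
  simp
  ring
end

section
/- Let d be an odd prime and j, j', k, k' ∈ ℤ/dℤ. If j = j', then ⟨φ_k^{(j)}, φ_{k'}^{(j')}⟩ = 1 if k = k' and 0 otherwise. If j ≠ j', then ⟨φ_k^{(j)}, φ_{k'}^{(j')}⟩ = ω^{(k')² − k² − (4(j'−j))^{-1}·(k−k')²} · ((j'−j) | d) · c_d/√d, where (4(j'−j))^{-1} denotes the multiplicative inverse of 4(j'−j) in ℤ/dℤ. -/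
open Finset Complex

/-- `ω^a` for `a : ZMod d`, where `ω = exp(2πi/d)`; well defined since `ω^d = 1`. -/
noncomputable def mubOmega (d : ℕ) (a : ZMod d) : ℂ :=
  Complex.exp (2 * Real.pi * Complex.I * (a.val : ℂ) / d)

/-- The mutually unbiased basis vectors `φ_k^{(j)} ∈ ℂ^{ℤ/dℤ}` with entries
`(φ_k^{(j)})_ℓ = (1/√d)·ω^{−kℓ + jℓ² + k²}`. -/
noncomputable def mubPhi (d : ℕ) (j k : ZMod d) : ZMod d → ℂ :=
  fun ℓ => (1 / (Real.sqrt d : ℂ)) * mubOmega d (-k * ℓ + j * ℓ ^ 2 + k ^ 2)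

/-- The inner product `⟨u, v⟩ = Σ_ℓ conj(u_ℓ)·v_ℓ` on `ℂ^{ℤ/dℤ}`,
conjugate-linear in the first argument. -/
noncomputable def mubInner (d : ℕ) [NeZero d] (u v : ZMod d → ℂ) : ℂ :=
  ∑ ℓ : ZMod d, (starRingEnd ℂ) (u ℓ) * v ℓ

/-- `S^{(j,j')} = Σ_{k,k'} ⟨φ_k^{(j)}, φ_{k'}^{(j')}⟩`. -/
noncomputable def mubS (d : ℕ) [NeZero d] (j j' : ZMod d) : ℂ :=
  ∑ k : ZMod d, ∑ k' : ZMod d, mubInner d (mubPhi d j k) (mubPhi d j' k')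

/-- `c_d = 1` if `d ≡ 1 (mod 4)` and `c_d = i` if `d ≡ 3 (mod 4)`. -/
noncomputable def mubC (d : ℕ) : ℂ :=
  if d % 4 = 1 then 1 else Complex.I

theorem ringChar_zmod_ne_two {d : ℕ} (hodd : Odd d) : ringChar (ZMod d) ≠ 2 := by
  rw [ZMod.ringChar_zmod_n]
  rintro rfl
  exact absurd hodd (by decide)

open Polynomial in
theorem cyclotomic_prime_zmod (p : ℕ) [Fact p.Prime] :
    cyclotomic p (ZMod p) = (X - 1) ^ (p - 1) := by
  have h := cyclotomic_mul_prime_eq_pow_of_not_dvd (ZMod p) (p := p) (n := 1)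
    (Fact.out : p.Prime).not_dvd_one
  rwa [one_mul, cyclotomic_one] at h

open Polynomial in
/-- Over `ZMod p`, the polynomial `∑ jⁿ Xʲ` is divisible by `(X - 1) ^ (p - 1 - n)`, and the cofactor
takes the value `(-1)ⁿ n!` at `1`. -/
theorem exists_sum_pow_mul_X_pow_eq (p : ℕ) [Fact p.Prime] (n : ℕ) (hn : n ≤ p - 1) :
    ∃ c : (ZMod p)[X], ∑ j ∈ range p, C ((j : ZMod p) ^ n) * X ^ j = (X - 1) ^ (p - 1 - n) * c ∧
      c.eval 1 = (-1) ^ n * (n.factorial : ZMod p) := by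
  induction n with
  | zero =>
    refine ⟨1, ?_, by simp⟩
    have h := cyclotomic_prime_zmod p
    rw [cyclotomic_prime] at h
    simpa using h
  | succ n ih =>
    obtain ⟨c, hc, hc1⟩ := ih (by omega)
    obtain ⟨q, hq⟩ : ∃ q, p - 1 - n = q + 1 := ⟨p - 1 - (n + 1), by omega⟩
    have hq' : p - 1 - (n + 1) = q := by omega
    have hcast : (q : ZMod p) + 1 = -(n + 1) := by
      have h : ((q + 1 + n + 1 : ℕ) : ZMod p) = 0 := by
        rw [show q + 1 + n + 1 = p by omega, ZMod.natCast_self]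
      push_cast at h
      linear_combination h
    refine ⟨C ((q : ZMod p) + 1) * X * c + X * (X - 1) * derivative c, ?_, ?_⟩
    · have hd := congrArg (fun f => X * derivative f) hc
      rw [hq] at hd
      simp only [derivative_sum, derivative_mul, derivative_C, derivative_pow,
        derivative_sub, derivative_X, derivative_one, zero_mul, zero_add, mul_one, mul_sum] at hd
      rw [hq']
      trans ∑ j ∈ range p, X * (C ((j : ZMod p) ^ n) * (C (j : ZMod p) * X ^ (j - 1)))
      · refine sum_congr rfl fun j _ => ?_
        rcases j with _ | j
        · simp
        · simp only [C_pow, Nat.add_sub_cancel]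
          ring
      · rw [hd]
        simp only [Nat.add_sub_cancel, Nat.cast_add, Nat.cast_one, C_add, C_1]
        ring
    · simp only [eval_add, eval_mul, eval_C, eval_X, eval_sub, eval_one, hc1, hcast,
        Nat.factorial_succ]
      push_cast
      ring

open Polynomial in
/-- The polynomial `∏ X ^ (m k) (1 - X ^ k)`, the product running over `1 ≤ k ≤ m`. -/
noncomputable def halfProduct (R : Type*) [CommRing R] (m : ℕ) : R[X] :=
  ∏ k ∈ range m, X ^ (m * (k + 1)) * (1 - X ^ (k + 1))

open Polynomial in
theorem exists_halfProduct_eq (R : Type*) [CommRing R] (m : ℕ) :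
    ∃ c : R[X], halfProduct R m = (X - 1) ^ m * c ∧ c.eval 1 = (-1) ^ m * (m.factorial : R) := by
  refine ⟨∏ k ∈ range m, -(X ^ (m * (k + 1)) * ∑ i ∈ range (k + 1), X ^ i), ?_, ?_⟩
  · conv_rhs => rw [← card_range m, ← prod_const, card_range, ← prod_mul_distrib]
    refine prod_congr rfl fun k _ => ?_
    linear_combination (X : R[X]) ^ (m * (k + 1)) * mul_geom_sum (X : R[X]) (k + 1)
  · rw [eval_prod, ← prod_range_add_one_eq_factorial]
    push_cast
    rw [← card_range m, ← prod_const, card_range, ← prod_mul_distrib]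
    exact prod_congr rfl fun k _ => by simp [eval_finsetSum]

theorem prod_neg_one_pow_mul_neg_I (t : ℕ) :
    ∏ k ∈ range (2 * t), ((-1) ^ (k + 1) * -I) = 1 := by
  induction t with
  | zero => simp
  | succ t ih =>
    rw [mul_add, mul_one, prod_range_succ, prod_range_succ, ih]
    simp only [pow_succ, pow_mul]
    norm_num

theorem exists_pos_aeval_halfProduct_eq (m : ℕ) :
    ∃ r : ℝ, 0 < r ∧ Polynomial.aeval (exp (2 * Real.pi * I / (2 * m + 1 : ℕ))) (halfProduct ℤ m) =
      mubC (2 * m + 1) * r := by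
  refine ⟨∏ k ∈ range m, 2 * Real.sin (Real.pi * (k + 1) / (2 * m + 1)), ?_, ?_⟩
  · refine prod_pos fun k hk => mul_pos two_pos (Real.sin_pos_of_pos_of_lt_pi (by positivity) ?_)
    have hkm : (k : ℝ) + 1 ≤ m := by exact_mod_cast mem_range.mp hk
    rw [div_lt_iff₀ (by positivity)]
    exact mul_lt_mul_of_pos_left (by linarith) Real.pi_pos
  · have hc : mubC (2 * m + 1) = ∏ k ∈ range m, ((-1) ^ (k + 1) * -I) := by
      rcases Nat.even_or_odd' m with ⟨t, rfl | rfl⟩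
      · rw [prod_neg_one_pow_mul_neg_I, mubC, if_pos (by omega)]
      · rw [prod_range_succ, prod_neg_one_pow_mul_neg_I, mubC, if_neg (by omega)]
        simp [pow_succ, pow_mul]
    rw [hc, halfProduct, map_prod, ofReal_prod, ← prod_mul_distrib]
    refine prod_congr rfl fun k _ => ?_
    have hm : (2 * m + 1 : ℂ) ≠ 0 := by exact_mod_cast (2 * m).succ_ne_zero
    set x : ℂ := Real.pi * (k + 1) / (2 * m + 1) with hx
    have h1 : exp (2 * Real.pi * I / (2 * m + 1 : ℕ)) ^ (k + 1) = exp (x * I) ^ 2 := by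
      rw [← exp_nat_mul, ← exp_nat_mul, hx]
      push_cast
      congr 1
      field_simp
    have h2 : exp (x * I) ^ (2 * m) * exp (x * I) = (-1) ^ (k + 1) := by
      rw [← pow_succ, ← exp_nat_mul, ← exp_pi_mul_I, ← exp_nat_mul, hx]
      push_cast
      congr 1
      field_simp
    have h3 : exp (-x * I) * exp (x * I) = 1 := by
      rw [← exp_add, neg_mul, neg_add_cancel, exp_zero]
    simp only [map_mul, map_sub, map_pow, map_one, Polynomial.aeval_X]
    rw [mul_comm m, pow_mul, h1]
    push_cast
    rw [← hx, ← h2, Complex.sin, ← pow_mul]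
    linear_combination (-exp (x * I) ^ (2 * m)) * h3 + exp (x * I) ^ (2 * m) * exp (x * I) *
      (exp (-x * I) - exp (x * I)) * I_sq

theorem norm_mubC (d : ℕ) : ‖mubC d‖ = 1 := by
  unfold mubC
  split_ifs <;> simp

theorem mubC_sq {d : ℕ} (hd : Odd d) : mubC d ^ 2 = (-1) ^ (d / 2) := by
  obtain ⟨m, rfl⟩ := hd
  rcases Nat.even_or_odd' m with ⟨t, rfl | rfl⟩
  · rw [mubC, if_pos (by omega), show (2 * (2 * t) + 1) / 2 = 2 * t by omega, pow_mul]
    simp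
  · rw [mubC, if_neg (by omega), show (2 * (2 * t + 1) + 1) / 2 = 2 * t + 1 by omega,
      I_sq, pow_succ, pow_mul]
    simp

theorem norm_sq_aeval_halfProduct (m : ℕ) {z : ℂ} (hz : IsPrimitiveRoot z (2 * m + 1)) :
    ‖Polynomial.aeval z (halfProduct ℤ m)‖ ^ 2 = 2 * m + 1 := by
  have hz1 : ‖z‖ = 1 := hz.norm'_eq_one (by omega)
  have h1 : ‖Polynomial.aeval z (halfProduct ℤ m)‖ = ∏ k ∈ range m, ‖1 - z ^ (k + 1)‖ := by
    simp [halfProduct, map_prod, hz1]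
  have h2 : ∏ k ∈ range m, ‖1 - z ^ (m + k + 1)‖ = ∏ k ∈ range m, ‖1 - z ^ (k + 1)‖ := by
    rw [← prod_range_reflect]
    refine prod_congr rfl fun k hk => ?_
    have hk := mem_range.mp hk
    have h : z ^ (m + (m - 1 - k) + 1) * z ^ (k + 1) = 1 := by
      rw [← pow_add, show m + (m - 1 - k) + 1 + (k + 1) = 2 * m + 1 by omega, hz.pow_eq_one]
    calc ‖1 - z ^ (m + (m - 1 - k) + 1)‖ = ‖(1 - z ^ (m + (m - 1 - k) + 1)) * z ^ (k + 1)‖ := by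
          simp [hz1]
      _ = ‖1 - z ^ (k + 1)‖ := by rw [sub_mul, h, one_mul, norm_sub_rev]
  have h3 := congrArg norm hz.prod_one_sub_pow_eq_order
  rw [two_mul, prod_range_add, norm_mul, norm_prod, norm_prod, h2, ← h1, ← sq] at h3
  rw [h3, two_mul]
  norm_cast

theorem aeval_halfProduct (m : ℕ) :
    Polynomial.aeval (exp (2 * Real.pi * I / (2 * m + 1 : ℕ))) (halfProduct ℤ m) =
      mubC (2 * m + 1) * Real.sqrt (2 * m + 1 : ℕ) := by
  obtain ⟨r, hr, h⟩ := exists_pos_aeval_halfProduct_eq m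
  have hn := norm_sq_aeval_halfProduct m (isPrimitiveRoot_exp (2 * m + 1) (by omega))
  rw [h, norm_mul, norm_mubC, one_mul, norm_real, Real.norm_of_nonneg hr.le] at hn
  rw [h, ← Real.sqrt_sq hr.le, hn]
  push_cast
  rfl

theorem stdAddChar_natCast (d : ℕ) [NeZero d] (n : ℕ) :
    ZMod.stdAddChar (n : ZMod d) = exp (2 * Real.pi * I / d) ^ n := by
  have h := ZMod.stdAddChar_coe (N := d) n
  rw [Int.cast_natCast, Int.cast_natCast] at h
  rw [h, ← exp_nat_mul]
  congr 1
  ring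

theorem mubOmega_eq_stdAddChar (d : ℕ) [NeZero d] (a : ZMod d) :
    mubOmega d a = ZMod.stdAddChar a := by
  rw [ZMod.stdAddChar_apply, ZMod.toCircle_apply, mubOmega]

/-- The quadratic Gauss sum of an odd prime `d`, including its sign. -/
theorem gaussSum_quadraticChar (d : ℕ) [NeZero d] [Fact d.Prime] (hodd : Odd d) :
    gaussSum ((quadraticChar (ZMod d)).ringHomComp (Int.castRingHom ℂ)) ZMod.stdAddChar =
      mubC d * Real.sqrt d := by
  have hchar := ringChar_zmod_ne_two hodd
  set χ := (quadraticChar (ZMod d)).ringHomComp (Int.castRingHom ℂ) with hχ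
  have hsq : gaussSum χ ZMod.stdAddChar ^ 2 = (mubC d * Real.sqrt d) ^ 2 := by
    rw [gaussSum_sq (MulChar.ringHomComp_ne_one_iff (RingHom.injective_int _) |>.mpr
      (quadraticChar_ne_one hchar)) (quadraticChar_isQuadratic _ |>.comp _)
      (ZMod.isPrimitive_stdAddChar d), mul_pow, mubC_sq hodd, ← ofReal_pow,
      Real.sq_sqrt d.cast_nonneg, ZMod.card, MulChar.ringHomComp_apply, quadraticChar_neg_one hchar,
      ZMod.card, ZMod.χ₄_eq_neg_one_pow (Nat.odd_iff.mp hodd)]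
    simp
  obtain ⟨m, hm⟩ := hodd
  have hd2 : d / 2 = m := by omega
  have hm0 : 0 < m := by
    have := (Fact.out : d.Prime).two_le
    omega
  set z := exp (2 * Real.pi * I / d) with hz
  have hprim : IsPrimitiveRoot z d := isPrimitiveRoot_exp d (NeZero.ne d)
  have hP : Polynomial.aeval z (halfProduct ℤ m) = mubC d * Real.sqrt d := by
    have h := aeval_halfProduct m
    rwa [← hm, ← hz] at h
  obtain ⟨ε, hε, hg⟩ : ∃ ε : ℤ, (ε = 1 ∨ ε = -1) ∧
      gaussSum χ ZMod.stdAddChar = ε * (mubC d * Real.sqrt d) := by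
    rcases sq_eq_sq_iff_eq_or_eq_neg.mp hsq with h | h
    · exact ⟨1, .inl rfl, by simpa using h⟩
    · exact ⟨-1, .inr rfl, by simpa using h⟩
  let G : Polynomial ℤ := ∑ j ∈ range d,
    Polynomial.C (quadraticChar (ZMod d) (j : ZMod d)) * Polynomial.X ^ j
  have hG : Polynomial.aeval z G = gaussSum χ ZMod.stdAddChar := by
    have h : gaussSum χ ZMod.stdAddChar =
        ∑ j ∈ range d, χ (j : ZMod d) * ZMod.stdAddChar (j : ZMod d) := by
      symm
      refine sum_bij' (fun j _ => (j : ZMod d)) (fun a _ => a.val) (fun _ _ => mem_univ _)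
        (fun a _ => mem_range.mpr a.val_lt) (fun j hj => ?_) (fun a _ => ?_) (fun _ _ => rfl)
      · exact ZMod.val_cast_of_lt (mem_range.mp hj)
      · exact ZMod.natCast_zmod_val a
    rw [h, map_sum]
    refine sum_congr rfl fun j _ => ?_
    rw [stdAddChar_natCast, ← hz]
    simp [hχ]
  have hdvd : Polynomial.cyclotomic d ℤ ∣ G - Polynomial.C ε * halfProduct ℤ m := by
    rw [Polynomial.cyclotomic_eq_minpoly hprim (NeZero.pos d)]
    refine minpoly.isIntegrallyClosed_dvd (hprim.isIntegral (NeZero.pos d)) ?_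
    rw [map_sub, map_mul, hG, hP, hg]
    simp
  obtain ⟨f, hf⟩ := hdvd
  have hf' := congrArg (Polynomial.map (Int.castRingHom (ZMod d))) hf
  obtain ⟨b, hb, hb1⟩ := exists_sum_pow_mul_X_pow_eq d m (by omega)
  obtain ⟨c, hc, hc1⟩ := exists_halfProduct_eq (ZMod d) m
  have hGmap : G.map (Int.castRingHom (ZMod d)) = (Polynomial.X - 1) ^ m * b := by
    rw [show d - 1 - m = m by omega] at hb
    rw [← hb, Polynomial.map_sum]
    refine sum_congr rfl fun j _ => ?_
    rw [Polynomial.map_mul, Polynomial.map_C, Polynomial.map_pow, Polynomial.map_X,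
      eq_intCast, quadraticChar_eq_pow_of_char_ne_two' hchar, ZMod.card, hd2]
  have hPmap : (halfProduct ℤ m).map (Int.castRingHom (ZMod d)) = (Polynomial.X - 1) ^ m * c := by
    rw [← hc]
    simp [halfProduct, Polynomial.map_prod]
  have hcyc : Polynomial.cyclotomic d (ZMod d) =
      (Polynomial.X - 1) ^ m * (Polynomial.X - 1) ^ m := by
    rw [cyclotomic_prime_zmod, ← pow_add]
    congr 1
    omega
  rw [Polynomial.map_sub, Polynomial.map_mul, Polynomial.map_mul, hGmap, hPmap, Polynomial.map_C,
    Polynomial.map_cyclotomic, hcyc, eq_intCast] at hf'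
  have hcancel : b - Polynomial.C (ε : ZMod d) * c =
      (Polynomial.X - 1) ^ m * f.map (Int.castRingHom (ZMod d)) := by
    refine mul_left_cancel₀ (pow_ne_zero m (Polynomial.X_sub_C_ne_zero (1 : ZMod d))) ?_
    rw [Polynomial.C_1]
    linear_combination hf'
  have heval := congrArg (Polynomial.eval 1) hcancel
  simp only [Polynomial.eval_sub, Polynomial.eval_mul, Polynomial.eval_C, Polynomial.eval_pow,
    Polynomial.eval_X, Polynomial.eval_one, sub_self, zero_pow hm0.ne', zero_mul, hb1, hc1] at heval
  have hfac : (-1) ^ m * (m.factorial : ZMod d) ≠ 0 := by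
    refine mul_ne_zero (pow_ne_zero _ (neg_ne_zero.mpr one_ne_zero)) fun h => ?_
    rw [ZMod.natCast_eq_zero_iff, (Fact.out : d.Prime).dvd_factorial] at h
    omega
  have hε1 : (ε : ZMod d) = 1 := mul_right_cancel₀ hfac (by linear_combination -heval)
  rcases hε with rfl | rfl
  · simpa using hg
  · refine absurd ?_ (Ring.neg_one_ne_one_of_char_ne_two hchar)
    simpa using hε1

theorem sum_stdAddChar_mul_sq (d : ℕ) [NeZero d] [Fact d.Prime] (hodd : Odd d) {a : ZMod d}
    (ha : a ≠ 0) :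
    ∑ x : ZMod d, ZMod.stdAddChar (a * x ^ 2) =
      (quadraticChar (ZMod d) a : ℂ) * (mubC d * Real.sqrt d) := by
  have hchar := ringChar_zmod_ne_two hodd
  have h0 : ∑ t : ZMod d, ZMod.stdAddChar (a * t) = 0 := by
    simpa [ha, mul_comm] using AddChar.sum_mulShift a (ZMod.isPrimitive_stdAddChar d)
  have h1 := gaussSum_mulShift_eq ((quadraticChar (ZMod d)).ringHomComp (Int.castRingHom ℂ))
    ZMod.stdAddChar (Units.mk0 a ha)
  rw [gaussSum_quadraticChar d hodd, ((quadraticChar_isQuadratic _).comp _).inv, gaussSum] at h1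
  simp only [Units.val_mk0, MulChar.ringHomComp_apply, eq_intCast, AddChar.mulShift_apply] at h1
  rw [← h1, ← add_zero (∑ t : ZMod d, _ * _), ← h0, ← sum_add_distrib,
    ← sum_fiberwise (s := univ) (g := fun x : ZMod d => x ^ 2)]
  refine sum_congr rfl fun t _ => ?_
  have hcard := congrArg (Int.cast : ℤ → ℂ) (quadraticChar_card_sqrts hchar t)
  rw [sum_congr rfl (g := fun _ => ZMod.stdAddChar (a * t))
    fun x hx => by rw [(mem_filter.mp hx).2], sum_const, nsmul_eq_mul]
  have hset : {x : ZMod d | x ^ 2 = t}.toFinset = univ.filter fun x => x ^ 2 = t := by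
    ext
    simp
  rw [hset] at hcard
  push_cast at hcard
  rw [hcard]
  ring

theorem mubInner_mubPhi (d : ℕ) [NeZero d] (j j' k k' : ZMod d) :
    mubInner d (mubPhi d j k) (mubPhi d j' k') =
      ZMod.stdAddChar (k' ^ 2 - k ^ 2) / d *
        ∑ x : ZMod d, ZMod.stdAddChar ((j' - j) * x ^ 2 + (k - k') * x) := by
  have hsqrt : (1 / (Real.sqrt d : ℂ)) * (1 / (Real.sqrt d : ℂ)) = 1 / d := by
    rw [div_mul_div_comm, ← ofReal_mul, Real.mul_self_sqrt d.cast_nonneg]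
    simp
  rw [mubInner, mul_sum]
  refine sum_congr rfl fun x _ => ?_
  simp only [mubPhi, mubOmega_eq_stdAddChar, map_mul, map_div₀, map_one, conj_ofReal,
    ← AddChar.map_neg_eq_conj]
  rw [mul_mul_mul_comm, hsqrt, ← AddChar.map_add_eq_mul, div_mul_eq_mul_div,
    one_mul, div_mul_eq_mul_div, ← AddChar.map_add_eq_mul]
  congr 2
  ring

/-- Explicit formula for the inner products of the mutually unbiased basis vectors:
if `j = j'` the bases are orthonormal, and if `j ≠ j'` then
`⟨φ_k^{(j)}, φ_{k'}^{(j')}⟩ = ω^{(k')² − k² − (4(j'−j))⁻¹(k−k')²}·((j'−j)|d)·c_d/√d`. -/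
theorem stmt_13 (d : ℕ) [NeZero d] [Fact d.Prime] (hodd : Odd d)
    (j j' k k' : ZMod d) :
    (j = j' →
      mubInner d (mubPhi d j k) (mubPhi d j' k') = if k = k' then 1 else 0) ∧
    (j ≠ j' →
      mubInner d (mubPhi d j k) (mubPhi d j' k') =
        mubOmega d (k' ^ 2 - k ^ 2 - (4 * (j' - j))⁻¹ * (k - k') ^ 2) *
          (legendreSym d ((j' - j).val : ℤ) : ℂ) * mubC d / (Real.sqrt d : ℂ)) := by
  have hd : (d : ℂ) ≠ 0 := by exact_mod_cast NeZero.ne d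
  refine ⟨?_, fun hj => ?_⟩
  · rintro rfl
    rw [mubInner_mubPhi]
    have h := AddChar.sum_mulShift (k - k') (ZMod.isPrimitive_stdAddChar d)
    simp only [sub_self, zero_mul, zero_add, mul_comm (k - k'), h, sub_eq_zero, ZMod.card]
    split_ifs with hk
    · subst hk
      simp [hd]
    · simp
  · have ha : j' - j ≠ 0 := sub_ne_zero.mpr hj.symm
    have h2 : (2 : ZMod d) ≠ 0 := Ring.two_ne_zero (ringChar_zmod_ne_two hodd)
    have h4 : (4 * (j' - j))⁻¹ * (4 * (j' - j)) = 1 :=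
      inv_mul_cancel₀ (mul_ne_zero (by rw [show (4 : ZMod d) = 2 * 2 by norm_num]; simp [h2]) ha)
    rw [mubInner_mubPhi, mubOmega_eq_stdAddChar]
    set s := (4 * (j' - j))⁻¹
    have hsum : ∑ x : ZMod d, ZMod.stdAddChar ((j' - j) * x ^ 2 + (k - k') * x) =
        ZMod.stdAddChar (-(s * (k - k') ^ 2)) *
          ∑ x : ZMod d, ZMod.stdAddChar ((j' - j) * x ^ 2) := by
      rw [← Equiv.sum_comp (Equiv.addRight (2 * s * (k - k'))) (fun x =>
        ZMod.stdAddChar ((j' - j) * x ^ 2)), mul_sum]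
      refine sum_congr rfl fun x _ => ?_
      rw [← AddChar.map_add_eq_mul, Equiv.coe_addRight]
      congr 1
      linear_combination (-(k - k') * x - s * (k - k') ^ 2) * h4
    have hleg : legendreSym d ((j' - j).val : ℤ) = quadraticChar (ZMod d) (j' - j) := by
      rw [legendreSym, Int.cast_natCast, ZMod.natCast_zmod_val]
    have hsq : (Real.sqrt d : ℂ) * Real.sqrt d = d := by
      rw [← ofReal_mul, Real.mul_self_sqrt d.cast_nonneg, ofReal_natCast]
    have hs0 : (Real.sqrt d : ℂ) ≠ 0 := fun h => hd (by rw [← hsq, h, zero_mul])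
    rw [hsum, sum_stdAddChar_mul_sq d hodd ha, hleg, sub_eq_add_neg _ (s * _),
      AddChar.map_add_eq_mul, ← hsq]
    field_simp
end

section
/- Let d be an odd prime and r an integer with 1 ≤ r ≤ d. Let A be the real (rd)×(rd) matrix indexed by pairs (j,k) with j ∈ {0,…,r−1} (viewed in ℤ/dℤ) and k ∈ ℤ/dℤ, defined by A[(j,k),(j',k')] = Re[ ⟨φ_k^{(j)}, φ_{k'}^{(j')}⟩ · conj(S^{(j,j')}) ], where S^{(j,j')} = Σ_{m,m' ∈ ℤ/dℤ} ⟨φ_m^{(j)}, φ_{m'}^{(j')}⟩. Then the ℓ₂→ℓ₂ operator norm of A satisfies ‖A‖ ≤ 2d, and the squared Frobenius norm satisfies Σ_{(j,k),(j',k')} A[(j,k),(j',k')]² ≤ 4d³r. -/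
open Finset Complex

theorem mubOmega_add (d : ℕ) [NeZero d] (a b : ZMod d) :
    mubOmega d (a + b) = mubOmega d a * mubOmega d b := by
  simp only [mubOmega_eq_stdAddChar, AddChar.map_add_eq_mul]

theorem conj_mubOmega (d : ℕ) [NeZero d] (a : ZMod d) :
    (starRingEnd ℂ) (mubOmega d a) = mubOmega d (-a) := by
  simp only [mubOmega_eq_stdAddChar, AddChar.map_neg_eq_conj]

theorem norm_mubOmega (d : ℕ) [NeZero d] (a : ZMod d) : ‖mubOmega d a‖ = 1 := by
  rw [mubOmega_eq_stdAddChar, ZMod.stdAddChar_apply, Circle.norm_coe]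

theorem sum_mubOmega_mul (d : ℕ) [NeZero d] (a : ZMod d) :
    ∑ n : ZMod d, mubOmega d (a * n) = if a = 0 then (d : ℂ) else 0 := by
  have h := AddChar.sum_mulShift a (ZMod.isPrimitive_stdAddChar d)
  simp only [ZMod.card] at h
  simpa only [mubOmega_eq_stdAddChar, mul_comm a, Nat.cast_ite, Nat.cast_zero] using h

/-- Parseval's identity for trigonometric sums on `ZMod d` with distinct frequencies. -/
theorem sum_norm_sq_sum_mul_mubOmega (d : ℕ) [NeZero d] {ι : Type*} [Fintype ι]
    (g : ι → ZMod d) (hg : Function.Injective g) (z : ι → ℂ) :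
    ∑ n : ZMod d, ‖∑ i, z i * mubOmega d (g i * n)‖ ^ 2 = d * ∑ i, ‖z i‖ ^ 2 := by
  classical
  apply Complex.ofReal_injective
  push_cast
  simp only [← Complex.mul_conj', map_sum, Finset.sum_mul_sum, map_mul, conj_mubOmega]
  have key : ∀ i j, ∑ n : ZMod d, z i * mubOmega d (g i * n) *
      ((starRingEnd ℂ) (z j) * mubOmega d (-(g j * n))) =
      if i = j then (d : ℂ) * (z i * (starRingEnd ℂ) (z j)) else 0 := by
    intro i j
    have h : ∀ n : ZMod d, z i * mubOmega d (g i * n) *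
        ((starRingEnd ℂ) (z j) * mubOmega d (-(g j * n))) =
        z i * (starRingEnd ℂ) (z j) * mubOmega d ((g i - g j) * n) := by
      intro n
      rw [show (g i - g j) * n = g i * n + -(g j * n) by ring, mubOmega_add]
      ring
    simp only [h, ← Finset.mul_sum, sum_mubOmega_mul, sub_eq_zero, hg.eq_iff, mul_ite, mul_zero]
    split_ifs <;> ring
  rw [Finset.sum_comm]
  simp_rw [Finset.sum_comm (s := (Finset.univ : Finset (ZMod d))), key]
  simp [Finset.mul_sum]

/-- The absolute value of a quadratic Gauss sum with a linear term. -/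
theorem conj_mul_self_sum_mubOmega_sq (d : ℕ) [NeZero d] [Fact d.Prime] (hodd : Odd d)
    (b : ZMod d) :
    (starRingEnd ℂ) (∑ k : ZMod d, mubOmega d (-k * b + k ^ 2)) *
      ∑ k : ZMod d, mubOmega d (-k * b + k ^ 2) = d := by
  have h2 : (2 : ZMod d) ≠ 0 := by
    apply Ring.two_ne_zero
    rw [ZMod.ringChar_zmod_n]
    rintro rfl
    exact absurd hodd (by decide)
  simp only [map_sum, conj_mubOmega, Finset.sum_mul_sum, ← mubOmega_add]
  have h : ∀ k : ZMod d,
      ∑ k' : ZMod d, mubOmega d (-(-k * b + k ^ 2) + (-k' * b + k' ^ 2)) =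
      ∑ t : ZMod d, mubOmega d (-t * b + t ^ 2) * mubOmega d ((2 * t) * k) := by
    intro k
    rw [← Equiv.sum_comp (Equiv.addRight k)]
    refine Finset.sum_congr rfl fun t _ => ?_
    rw [← mubOmega_add, Equiv.coe_addRight]
    congr 1
    ring
  simp_rw [h]
  rw [Finset.sum_comm]
  simp_rw [← Finset.mul_sum, sum_mubOmega_mul, mul_eq_zero, h2, false_or]
  simp [mubOmega]

theorem mubS_eq_sum_mubOmega (d : ℕ) [NeZero d] [Fact d.Prime] (hodd : Odd d)
    (j j' : ZMod d) : mubS d j j' = ∑ m : ZMod d, mubOmega d ((j' - j) * m ^ 2) := by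
  have hd : (d : ℂ) ≠ 0 := Nat.cast_ne_zero.2 (NeZero.ne d)
  have hs : (Real.sqrt d : ℂ) * Real.sqrt d = d := by
    rw [← Complex.ofReal_mul, Real.mul_self_sqrt (Nat.cast_nonneg d), Complex.ofReal_natCast]
  have hsum : ∀ i m : ZMod d, ∑ k : ZMod d, mubPhi d i k m =
      1 / (Real.sqrt d : ℂ) * mubOmega d (i * m ^ 2) *
        ∑ k : ZMod d, mubOmega d (-k * m + k ^ 2) := by
    intro i m
    rw [Finset.mul_sum]
    refine Finset.sum_congr rfl fun k _ => ?_
    rw [mubPhi, mul_assoc, ← mubOmega_add]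
    congr 2
    ring
  have hS : mubS d j j' = ∑ m : ZMod d,
      (starRingEnd ℂ) (∑ k : ZMod d, mubPhi d j k m) * ∑ k : ZMod d, mubPhi d j' k m := by
    simp only [mubS, mubInner, map_sum, Finset.sum_mul_sum]
    symm
    rw [Finset.sum_comm]
    exact Finset.sum_congr rfl fun k _ => Finset.sum_comm
  rw [hS]
  refine Finset.sum_congr rfl fun m _ => ?_
  have hG := conj_mul_self_sum_mubOmega_sq d hodd m
  rw [hsum, hsum, map_mul, map_mul, conj_mubOmega, map_div₀, map_one, Complex.conj_ofReal,
    show (j' - j) * m ^ 2 = -(j * m ^ 2) + j' * m ^ 2 by ring, mubOmega_add]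
  generalize ∑ k : ZMod d, mubOmega d (-k * m + k ^ 2) = G at hG ⊢
  generalize mubOmega d (-(j * m ^ 2)) = a
  generalize mubOmega d (j' * m ^ 2) = b
  have hs0 : (Real.sqrt d : ℂ) ≠ 0 := fun h => hd (by rw [← hs, h, zero_mul])
  field_simp
  linear_combination a * b * (hG - hs)

theorem sum_comp_sq_le (d : ℕ) [NeZero d] [Fact d.Prime] (f : ZMod d → ℝ) (hf : ∀ n, 0 ≤ f n) :
    ∑ m : ZMod d, f (m ^ 2) ≤ 2 * ∑ n : ZMod d, f n := by
  rw [Finset.sum_comp f (fun m : ZMod d => m ^ 2), Finset.mul_sum]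
  refine (Finset.sum_le_sum fun n hn => ?_).trans
    (Finset.sum_le_sum_of_subset_of_nonneg (Finset.subset_univ _)
      fun n _ _ => mul_nonneg zero_le_two (hf n))
  obtain ⟨m, -, rfl⟩ := Finset.mem_image.1 hn
  rw [nsmul_eq_mul]
  refine mul_le_mul_of_nonneg_right ?_ (hf _)
  have hsub : ({a | a ^ 2 = m ^ 2} : Finset (ZMod d)) ⊆ {m, -m} := by
    intro a ha
    simpa [sq_eq_sq_iff_eq_or_eq_neg] using ha
  exact_mod_cast (Finset.card_le_card hsub).trans Finset.card_le_two

/-- The factor `T` with `A = Re (Tᴴ T)`. -/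
noncomputable def mubFactor (d r : ℕ) [NeZero d] (x : Fin r × ZMod d → ℝ) :
    EuclideanSpace ℂ (ZMod d × ZMod d) :=
  WithLp.toLp 2 fun p => ∑ u : Fin r × ZMod d,
    (x u : ℂ) * (mubPhi d ((u.1 : ℕ) : ZMod d) u.2 p.1 *
      mubOmega d (-((u.1 : ℕ) : ZMod d) * p.2 ^ 2))

theorem norm_mubFactor_sq_le (d r : ℕ) [NeZero d] [Fact d.Prime] (hrd : r ≤ d)
    (x : Fin r × ZMod d → ℝ) : ‖mubFactor d r x‖ ^ 2 ≤ 2 * d * ∑ u, x u ^ 2 := by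
  have hd : (d : ℝ) ≠ 0 := Nat.cast_ne_zero.2 (NeZero.ne d)
  let X : Fin r → ZMod d → ℂ := fun j l => ∑ k, (x (j, k) : ℂ) * mubPhi d ((j : ℕ) : ZMod d) k l
  have hinj : Function.Injective fun j : Fin r => -((j : ℕ) : ZMod d) := by
    intro a b hab
    have h : ((a : ℕ) : ZMod d) = ((b : ℕ) : ZMod d) := neg_injective hab
    rw [ZMod.natCast_eq_natCast_iff', Nat.mod_eq_of_lt (a.2.trans_le hrd),
      Nat.mod_eq_of_lt (b.2.trans_le hrd)] at h
    exact Fin.ext h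
  have hX : ∀ j, ∑ l, ‖X j l‖ ^ 2 = ∑ k, x (j, k) ^ 2 := by
    intro j
    have hXl : ∀ l, ‖X j l‖ ^ 2 = (d : ℝ)⁻¹ *
        ‖∑ k : ZMod d, ((x (j, k) : ℂ) * mubOmega d (k ^ 2)) * mubOmega d (-k * l)‖ ^ 2 := by
      intro l
      have h : X j l = (1 / (Real.sqrt d : ℂ)) * mubOmega d (((j : ℕ) : ZMod d) * l ^ 2) *
          ∑ k : ZMod d, ((x (j, k) : ℂ) * mubOmega d (k ^ 2)) * mubOmega d (-k * l) := by
        rw [Finset.mul_sum]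
        refine Finset.sum_congr rfl fun k _ => ?_
        rw [mubPhi, mubOmega_add, mubOmega_add]
        ring
      rw [h, norm_mul, norm_mul, norm_mubOmega, mul_one, mul_pow, norm_div, norm_one,
        Complex.norm_real, Real.norm_of_nonneg (Real.sqrt_nonneg _), div_pow,
        Real.sq_sqrt (Nat.cast_nonneg d), one_pow, one_div]
    simp_rw [hXl]
    rw [← Finset.mul_sum, sum_norm_sq_sum_mul_mubOmega d (fun k => -k) neg_injective,
      inv_mul_cancel_left₀ hd]
    simp [norm_mubOmega]
  have hT : ∀ l m, mubFactor d r x (l, m) =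
      ∑ j : Fin r, X j l * mubOmega d (-((j : ℕ) : ZMod d) * m ^ 2) := by
    intro l m
    simp only [mubFactor, X, Fintype.sum_prod_type, Finset.sum_mul, mul_assoc]
  calc ‖mubFactor d r x‖ ^ 2
      = ∑ l, ∑ m, ‖∑ j : Fin r, X j l * mubOmega d (-((j : ℕ) : ZMod d) * m ^ 2)‖ ^ 2 := by
        rw [EuclideanSpace.norm_sq_eq, Fintype.sum_prod_type]
        simp_rw [hT]
    _ ≤ ∑ l, 2 * ∑ n, ‖∑ j : Fin r, X j l * mubOmega d (-((j : ℕ) : ZMod d) * n)‖ ^ 2 :=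
        Finset.sum_le_sum fun l _ => sum_comp_sq_le d
          (fun n => ‖∑ j : Fin r, X j l * mubOmega d (-((j : ℕ) : ZMod d) * n)‖ ^ 2)
          fun n => sq_nonneg _
    _ = ∑ l, 2 * (d * ∑ j : Fin r, ‖X j l‖ ^ 2) := by
        simp_rw [sum_norm_sq_sum_mul_mubOmega d _ hinj]
    _ = 2 * d * ∑ u, x u ^ 2 := by
        simp_rw [← Finset.mul_sum]
        rw [Finset.sum_comm, Fintype.sum_prod_type]
        simp_rw [hX]
        ring

theorem sum_mul_re_mubInner_mul_mubS (d r : ℕ) [NeZero d] [Fact d.Prime] (hodd : Odd d)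
    (x y : Fin r × ZMod d → ℝ) :
    ∑ u : Fin r × ZMod d, ∑ v : Fin r × ZMod d, x u *
      ((mubInner d (mubPhi d ((u.1 : ℕ) : ZMod d) u.2) (mubPhi d ((v.1 : ℕ) : ZMod d) v.2) *
        (starRingEnd ℂ) (mubS d ((u.1 : ℕ) : ZMod d) ((v.1 : ℕ) : ZMod d))).re * y v) =
      (inner ℂ (mubFactor d r x) (mubFactor d r y)).re := by
  have h : inner ℂ (mubFactor d r x) (mubFactor d r y) =
      ∑ u : Fin r × ZMod d, ∑ v : Fin r × ZMod d, (x u : ℂ) *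
      ((mubInner d (mubPhi d ((u.1 : ℕ) : ZMod d) u.2) (mubPhi d ((v.1 : ℕ) : ZMod d) v.2) *
        (starRingEnd ℂ) (mubS d ((u.1 : ℕ) : ZMod d) ((v.1 : ℕ) : ZMod d))) * y v) := by
    simp only [PiLp.inner_apply, RCLike.inner_apply', mubFactor, map_sum, Finset.sum_mul_sum]
    rw [Finset.sum_comm]
    refine Finset.sum_congr rfl fun u _ => ?_
    rw [Finset.sum_comm]
    refine Finset.sum_congr rfl fun v _ => ?_
    rw [mubS_eq_sum_mubOmega d hodd, map_sum, mubInner, Finset.sum_mul_sum, Finset.sum_mul,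
      Finset.mul_sum, Fintype.sum_prod_type]
    refine Finset.sum_congr rfl fun l _ => ?_
    rw [Finset.sum_mul, Finset.mul_sum]
    refine Finset.sum_congr rfl fun m _ => ?_
    rw [map_mul, map_mul, Complex.conj_ofReal, conj_mubOmega, conj_mubOmega,
      show -((((v.1 : ℕ) : ZMod d) - ((u.1 : ℕ) : ZMod d)) * m ^ 2) =
        -(-((u.1 : ℕ) : ZMod d) * m ^ 2) + -((v.1 : ℕ) : ZMod d) * m ^ 2 by ring, mubOmega_add]
    ring
  rw [h]
  simp only [Complex.re_sum, Complex.re_ofReal_mul, Complex.re_mul_ofReal]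

/-- The real `(rd)×(rd)` matrix `A[(j,k),(j',k')] = Re[⟨φ_k^{(j)}, φ_{k'}^{(j')}⟩·conj(S^{(j,j')})]`
has ℓ₂→ℓ₂ operator norm at most `2d` and squared Frobenius norm at most `4d³r`. -/
theorem stmt_15 (d : ℕ) [NeZero d] [Fact d.Prime] (hodd : Odd d)
    (r : ℕ) (hr1 : 1 ≤ r) (hrd : r ≤ d)
    (A : Matrix (Fin r × ZMod d) (Fin r × ZMod d) ℝ)
    (hA : A = Matrix.of fun u v : Fin r × ZMod d =>
      (mubInner d (mubPhi d ((u.1 : ℕ) : ZMod d) u.2) (mubPhi d ((v.1 : ℕ) : ZMod d) v.2) *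
        (starRingEnd ℂ) (mubS d ((u.1 : ℕ) : ZMod d) ((v.1 : ℕ) : ZMod d))).re) :
    ‖Matrix.toEuclideanCLM (𝕜 := ℝ) A‖ ≤ 2 * d ∧
      ∑ u : Fin r × ZMod d, ∑ v : Fin r × ZMod d, A u v ^ 2 ≤ 4 * d ^ 3 * r := by
  have hbound : ∀ x : EuclideanSpace ℝ (Fin r × ZMod d),
      ‖Matrix.toEuclideanCLM (𝕜 := ℝ) A x‖ ≤ 2 * d * ‖x‖ := by
    intro x
    set w := Matrix.toEuclideanCLM (𝕜 := ℝ) A x with hw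
    have hT : ∀ y : EuclideanSpace ℝ (Fin r × ZMod d),
        ‖mubFactor d r y‖ ≤ √(2 * d) * ‖y‖ := by
      intro y
      refine (sq_le_sq₀ (norm_nonneg _) (by positivity)).1 ?_
      rw [mul_pow, Real.sq_sqrt (by positivity), EuclideanSpace.real_norm_sq_eq]
      exact norm_mubFactor_sq_le d r hrd y
    have hww : ‖w‖ ^ 2 = (inner ℂ (mubFactor d r w) (mubFactor d r x)).re := by
      rw [← sum_mul_re_mubInner_mul_mubS d r hodd, EuclideanSpace.real_norm_sq_eq]
      refine Finset.sum_congr rfl fun u _ => ?_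
      rw [← Finset.mul_sum, sq]
      congr 1
      rw [hw, hA]
      rfl
    have h : ‖w‖ * ‖w‖ ≤ ‖w‖ * (2 * d * ‖x‖) := calc
      ‖w‖ * ‖w‖ = (inner ℂ (mubFactor d r w) (mubFactor d r x)).re := by rw [← hww, sq]
      _ ≤ ‖mubFactor d r w‖ * ‖mubFactor d r x‖ :=
        (Complex.re_le_norm _).trans (norm_inner_le_norm _ _)
      _ ≤ (√(2 * d) * ‖w‖) * (√(2 * d) * ‖x‖) := by
        gcongr <;> apply hT
      _ = ‖w‖ * (2 * d * ‖x‖) := by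
        rw [mul_mul_mul_comm, Real.mul_self_sqrt (by positivity)]
        ring
    rcases (norm_nonneg w).eq_or_lt with h0 | h0
    · rw [← h0]
      positivity
    · exact le_of_mul_le_mul_left h h0
  refine ⟨ContinuousLinearMap.opNorm_le_bound _ (by positivity) hbound, ?_⟩
  have hcol : ∀ v : Fin r × ZMod d, ∑ u, A u v ^ 2 ≤ (2 * d) ^ 2 := by
    intro v
    have h := pow_le_pow_left₀ (norm_nonneg _) (hbound (EuclideanSpace.single v 1)) 2
    rw [EuclideanSpace.real_norm_sq_eq] at h
    simpa [Matrix.col_apply] using h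
  rw [Finset.sum_comm]
  refine (Finset.sum_le_sum fun v _ => hcol v).trans_eq ?_
  simp only [Finset.sum_const, Finset.card_univ, Fintype.card_prod, Fintype.card_fin, ZMod.card,
    nsmul_eq_mul]
  push_cast
  ring
end

section
/- For every real ε with 0 < ε ≤ 1/6 and every real d ≥ 12, setting c = √(1 − 36ε²), one has −((3+c)/4)·log₂((3+c)/4) − ((1−c)/4)·log₂((1−c)/(2d)) ≤ 27·ε²·(1 + log₂(d/ε²)). -/
/-- For every real `ε` with `0 < ε ≤ 1/6` and every real `d ≥ 12`, setting
`c = √(1 − 36ε²)`, one has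
`−((3+c)/4)·log₂((3+c)/4) − ((1−c)/4)·log₂((1−c)/(2d)) ≤ 27·ε²·(1 + log₂(d/ε²))`. -/
theorem stmt_18 (ε d : ℝ) (hε0 : 0 < ε) (hε1 : ε ≤ 1 / 6) (hd : 12 ≤ d) :
    -((3 + Real.sqrt (1 - 36 * ε ^ 2)) / 4) *
        Real.logb 2 ((3 + Real.sqrt (1 - 36 * ε ^ 2)) / 4) -
      ((1 - Real.sqrt (1 - 36 * ε ^ 2)) / 4) *
        Real.logb 2 ((1 - Real.sqrt (1 - 36 * ε ^ 2)) / (2 * d)) ≤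
    27 * ε ^ 2 * (1 + Real.logb 2 (d / ε ^ 2)) := by
  have hsq : Real.sqrt (1 - 36 * ε ^ 2) ^ 2 = 1 - 36 * ε ^ 2 := Real.sq_sqrt (by nlinarith)
  have hc0 : 0 ≤ Real.sqrt (1 - 36 * ε ^ 2) := Real.sqrt_nonneg _
  set c := Real.sqrt (1 - 36 * ε ^ 2)
  have hε2 : 0 < ε ^ 2 := by positivity
  have hc1 : 0 < 1 - c := by nlinarith
  have hL2 : 0 < Real.log 2 := Real.log_pos one_lt_two
  have hp : -((3 + c) / 4) * Real.log ((3 + c) / 4) ≤ (1 - c) / 4 := by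
    have h := Real.one_sub_inv_le_log_of_pos (show 0 < (3 + c) / 4 by linarith)
    have h' := mul_le_mul_of_nonneg_left h (show 0 ≤ (3 + c) / 4 by linarith)
    rw [mul_sub, mul_inv_cancel₀ (by linarith)] at h'
    linarith
  have hinv : Real.log ((1 - c) / (2 * d)) = -Real.log (2 * d / (1 - c)) := by
    rw [← Real.log_inv, inv_div]
  have hlog : 1 ≤ Real.log (2 * d / (1 - c)) := by
    rw [Real.le_log_iff_exp_le (by positivity), le_div_iff₀ hc1]
    nlinarith [Real.exp_one_lt_d9, Real.exp_pos 1]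
  have hmono : Real.log (2 * d / (1 - c)) ≤ Real.log (d / ε ^ 2) := by
    apply Real.log_le_log (by positivity)
    rw [div_le_div_iff₀ hc1 hε2]
    have h : 2 * ε ^ 2 ≤ 1 - c := by nlinarith
    nlinarith
  have hq : 3 * ((1 - c) / 4) ≤ 27 * ε ^ 2 := by nlinarith
  have hmul := mul_le_mul hq hmono (by linarith) (by positivity)
  have hone := mul_le_mul_of_nonneg_left hlog (show 0 ≤ (1 - c) / 4 by linarith)
  have key : -((3 + c) / 4) * Real.log ((3 + c) / 4) -
      (1 - c) / 4 * Real.log ((1 - c) / (2 * d)) ≤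
      27 * ε ^ 2 * (Real.log 2 + Real.log (d / ε ^ 2)) := by
    rw [hinv]
    nlinarith [mul_pos hε2 hL2]
  calc _ = (-((3 + c) / 4) * Real.log ((3 + c) / 4) -
        (1 - c) / 4 * Real.log ((1 - c) / (2 * d))) / Real.log 2 := by
        simp only [Real.logb]; ring
    _ ≤ 27 * ε ^ 2 * (Real.log 2 + Real.log (d / ε ^ 2)) / Real.log 2 := by gcongr
    _ = _ := by
        simp only [Real.logb]; field_simp
end
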